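/- Under the hypotheses and notation of Lemma 3.6 (x* ≠ 0 a strong β-Lagrangian stationary point with multiplier y*, Lipschitz constant L₁ for ∇_x L near z* = (x*;y*) on a ball of radius δ₀, and δ* = min{δ₀, δ₁} with δ₁ = (min_{i ∈ Γ*}|x*_i| − β max_{i ∉ Γ*}|q*_i|)/(√2(1+βL₁))), if moreover ‖x*‖₀ = s, then for every z = (x; y) with ‖x‖₀ ≤ s and ‖z − z*‖ < δ*, one has {supp(x)} = 𝕋(x, y; β) = 𝕋(x*, y*; β) = {Γ*}; in particular supp(x) = Γ*. -/

import Mathlib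

open scoped BigOperators
open Filter Topology

noncomputable section

/-- `E n` is Euclidean space `ℝⁿ`. -/
abbrev E (n : ℕ) : Type := EuclideanSpace ℝ (Fin n)

/-- Pack a plain function as a vector of the corresponding Euclidean space. -/
def toE {ι : Type} (v : ι → ℝ) : EuclideanSpace ℝ ι := (WithLp.equiv 2 _).symm v

/-- `‖x‖₀`, the number of nonzero components of `x`. -/
def norm0 {n : ℕ} (x : E n) : ℕ := (Finset.univ.filter fun i => x i ≠ 0).card

/-- `supp(x)`, the support of `x`. -/
def spt {n : ℕ} (x : E n) : Finset (Fin n) := Finset.univ.filter fun i => x i ≠ 0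

/-- The sparse constraint set `S = {x : ‖x‖₀ ≤ s}`. -/
def Sset (n s : ℕ) : Set (E n) := {x | norm0 x ≤ s}

/-- The (set-valued) Euclidean projection onto `S`: `Π_S(z) = argmin_{w ∈ S} ‖z - w‖²`. -/
def projS (n s : ℕ) (z : E n) : Set (E n) :=
  {p | p ∈ Sset n s ∧ ∀ w ∈ Sset n s, ‖z - p‖ ^ 2 ≤ ‖z - w‖ ^ 2}

/-- `∇ₓL(x,y) = ∇f(x) - (∇h(x))ᵀ y`. -/
def gradL {n m : ℕ} (f : E n → ℝ) (h : E n → E m) (x : E n) (y : E m) : E n :=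
  gradient f x - ∑ k, y k • gradient (fun u => h u k) x

/-- `x` is a strong `β`-Lagrangian stationary point with multiplier `y`. -/
def StrongLS {n m : ℕ} (s : ℕ) (f : E n → ℝ) (h : E n → E m) (β : ℝ)
    (x : E n) (y : E m) : Prop :=
  x ∈ projS n s (x - β • gradL f h x y) ∧ h x = 0

/-- `𝕋(x,y;β)`: collection of sparse projection index sets of `u = x - β ∇ₓL(x,y)`. -/
def Tsets {n m : ℕ} (s : ℕ) (f : E n → ℝ) (h : E n → E m) (β : ℝ) (x : E n) (y : E m) :
    Set (Finset (Fin n)) :=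
  {T | T.card = s ∧ ∀ i ∈ T, ∀ j ∉ T,
    |(x - β • gradL f h x y) j| ≤ |(x - β • gradL f h x y) i|}

/-- The Lagrangian-equation map `F(x,y;T) = ((∇ₓL(x,y))_T ; x_{Tᶜ} ; -h(x)) ∈ ℝ^{n+m}`
(with the first two blocks interleaved in the natural coordinate order). -/
def Fvec {n m : ℕ} (f : E n → ℝ) (h : E n → E m) (T : Finset (Fin n)) (x : E n) (y : E m) :
    EuclideanSpace ℝ (Fin n ⊕ Fin m) :=
  toE (Sum.elim (fun i => if i ∈ T then gradL f h x y i else x i) (fun k => -(h x k)))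

/-- Hessian matrix of a scalar function on `ℝⁿ`. -/
def hess {n : ℕ} (g : E n → ℝ) (x : E n) : Matrix (Fin n) (Fin n) ℝ :=
  Matrix.of fun i j =>
    fderiv ℝ (fun u => fderiv ℝ g u (EuclideanSpace.single j 1)) x (EuclideanSpace.single i 1)

/-- `∇²ₓₓ L(x,y) = ∇²f(x) - Σ_k y_k ∇²h_k(x)`. -/
def hessL {n m : ℕ} (f : E n → ℝ) (h : E n → E m) (x : E n) (y : E m) :
    Matrix (Fin n) (Fin n) ℝ :=
  hess f x - ∑ k, y k • hess (fun u => h u k) x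

/-- `∇h(x)`: the `m × n` matrix whose rows are `∇h_k(x)ᵀ`. -/
def gradh {n m : ℕ} (h : E n → E m) (x : E n) : Matrix (Fin m) (Fin n) ℝ :=
  Matrix.of fun k j => gradient (fun u => h u k) x j

/-- The Jacobian `∇_{(x,y)} F(x,y;T)`, with block rows
`[(∇²ₓₓL)_{T,·}, -(∇_T h)ᵀ]`, `[I_{Tᶜ,·}, 0]`, `[-∇h, 0]`
(the first two row blocks interleaved in natural coordinate order). -/
def JacF {n m : ℕ} (f : E n → ℝ) (h : E n → E m) (T : Finset (Fin n)) (x : E n) (y : E m) :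
    Matrix (Fin n ⊕ Fin m) (Fin n ⊕ Fin m) ℝ :=
  Matrix.of fun r c =>
    match r, c with
    | Sum.inl i, Sum.inl j =>
        if i ∈ T then hessL f h x y i j else (if i = j then (1 : ℝ) else 0)
    | Sum.inl i, Sum.inr k => if i ∈ T then -(gradh h x k i) else 0
    | Sum.inr k, Sum.inl j => -(gradh h x k j)
    | Sum.inr _, Sum.inr _ => 0

/-- The reduced Jacobian `G(x,y;T) = [[(∇²ₓₓL)_{T,T}, -(∇_T h)ᵀ], [-∇_T h, 0]]`. -/
def Gmat {n m : ℕ} (f : E n → ℝ) (h : E n → E m) (T : Finset (Fin n)) (x : E n) (y : E m) :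
    Matrix ({i // i ∈ T} ⊕ Fin m) ({i // i ∈ T} ⊕ Fin m) ℝ :=
  Matrix.of fun r c =>
    match r, c with
    | Sum.inl i, Sum.inl j => hessL f h x y i.1 j.1
    | Sum.inl i, Sum.inr k => -(gradh h x k i.1)
    | Sum.inr k, Sum.inl j => -(gradh h x k j.1)
    | Sum.inr _, Sum.inr _ => 0

/-- The full Hessian `∇²L(x,y) = [[∇²ₓₓL, -(∇h)ᵀ], [-∇h, 0]]`. -/
def fullHess {n m : ℕ} (f : E n → ℝ) (h : E n → E m) (x : E n) (y : E m) :
    Matrix (Fin n ⊕ Fin m) (Fin n ⊕ Fin m) ℝ :=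
  Matrix.of fun r c =>
    match r, c with
    | Sum.inl i, Sum.inl j => hessL f h x y i j
    | Sum.inl i, Sum.inr k => -(gradh h x k i)
    | Sum.inr k, Sum.inl j => -(gradh h x k j)
    | Sum.inr _, Sum.inr _ => 0

/-- Euclidean norm of the concatenated vector `z = (x; y) ∈ ℝ^{n+m}`. -/
def zNorm {n m : ℕ} (x : E n) (y : E m) : ℝ := Real.sqrt (‖x‖ ^ 2 + ‖y‖ ^ 2)

/-- `|x|_(s)`, the `s`-th largest component of `(|x_1|, …, |x_n|)`. -/
def kthLargest {n : ℕ} (x : E n) (s : ℕ) : ℝ :=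
  (((Finset.univ : Finset (Fin n)).val.map fun i => |x i|).sort (· ≤ ·)).getD (n - s) 0

/-- The stationarity measure `η_β(x,y;T)`. -/
def eta {n m : ℕ} (s : ℕ) (f : E n → ℝ) (h : E n → E m) (β : ℝ)
    (T : Finset (Fin n)) (x : E n) (y : E m) : ℝ :=
  ‖Fvec f h T x y‖ +
    (if hne : (Tᶜ : Finset (Fin n)).Nonempty then
      (Tᶜ).sup' hne fun i => max (|gradL f h x y i| - kthLargest x s / β) 0
    else 0)

/-- The Lagrange–Newton iteration: `T_k ∈ 𝕋(x^k, y^k; β)` and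
`∇_{(x,y)}F(x^k, y^k; T_k) (z^{k+1} - z^k) = -F(x^k, y^k; T_k)`. -/
def NewtonSeq {n m : ℕ} (s : ℕ) (f : E n → ℝ) (h : E n → E m) (β : ℝ)
    (xk : ℕ → E n) (yk : ℕ → E m) (Tk : ℕ → Finset (Fin n)) : Prop :=
  ∀ k : ℕ, Tk k ∈ Tsets s f h β (xk k) (yk k) ∧
    ∀ idx, (JacF f h (Tk k) (xk k) (yk k)).mulVec
        (Sum.elim (fun i => xk (k+1) i - xk k i) (fun j => yk (k+1) j - yk k j)) idx
      = -(Fvec f h (Tk k) (xk k) (yk k) idx)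

theorem aux_uniq {n : ℕ} (u : Fin n → ℝ) (G : Finset (Fin n)) (s : ℕ) (hG : G.card = s)
    (hu : ∀ i ∈ G, ∀ j ∉ G, |u j| < |u i|) :
    {T : Finset (Fin n) | T.card = s ∧ ∀ i ∈ T, ∀ j ∉ T, |u j| ≤ |u i|} = {G} := by
  ext T
  simp only [Set.mem_setOf_eq, Set.mem_singleton_iff]
  constructor
  · rintro ⟨hT, h⟩
    by_contra hne
    have h1 : ¬ G ⊆ T := fun hs => hne (Finset.eq_of_subset_of_card_le hs (by omega)).symm
    have h2 : ¬ T ⊆ G := fun hs => hne (Finset.eq_of_subset_of_card_le hs (by omega))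
    obtain ⟨i, hi, hi'⟩ := Finset.not_subset.1 h1
    obtain ⟨j, hj, hj'⟩ := Finset.not_subset.1 h2
    exact absurd (hu i hi j hj') (not_lt.2 (h j hj i hi'))
  · rintro rfl
    exact ⟨hG, fun i hi j hj => (hu i hi j hj).le⟩

theorem aux_zero {n s : ℕ} (xs g : E n) (hp : xs ∈ projS n s (xs - g)) (i : Fin n)
    (hi : xs i ≠ 0) : g i = 0 := by
  obtain ⟨h1, h2⟩ := hp
  have hw : xs - EuclideanSpace.single i (g i) ∈ Sset n s := by
    refine le_trans (Finset.card_le_card ?_) h1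
    intro j hj
    simp only [Finset.mem_filter, Finset.mem_univ, true_and] at hj ⊢
    by_cases hij : j = i
    · rw [hij]; exact hi
    · simpa [hij] using hj
  have h3 := h2 _ hw
  have e1 : xs - g - xs = -g := by abel
  have e2 : xs - g - (xs - EuclideanSpace.single i (g i)) =
    -(g - EuclideanSpace.single i (g i)) := by abel
  rw [e1, e2, norm_neg, norm_neg, norm_sub_sq_real, EuclideanSpace.inner_single_right] at h3
  simp at h3
  nlinarith [sq_nonneg (g i)]

theorem aux_two {n : ℕ} (d : E n) (i j : Fin n) (hij : i ≠ j) :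
    |d i| + |d j| ≤ Real.sqrt 2 * ‖d‖ := by
  have h : |d i| ^ 2 + |d j| ^ 2 ≤ ‖d‖ ^ 2 := by
    rw [EuclideanSpace.norm_sq_eq]
    have := Finset.sum_le_sum_of_subset_of_nonneg (Finset.subset_univ {i, j})
      (f := fun k => ‖d k‖ ^ 2) (fun k _ _ => sq_nonneg _)
    rw [Finset.sum_pair hij] at this
    simpa [Real.norm_eq_abs] using this
  apply abs_le_of_sq_le_sq' _ (by positivity) |>.2
  rw [mul_pow, Real.sq_sqrt (by norm_num)]
  nlinarith [sq_nonneg (|d i| - |d j|)]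

/-- Lemma 3.6, second part: if moreover `‖x*‖₀ = s`, then near `z*` one has
`{supp(x)} = 𝕋(x,y;β) = 𝕋(x*,y*;β) = {Γ*}`. -/
theorem statement_11 {n m s : ℕ} (hs0 : 0 < s) (hsn : s < n)
    (f : E n → ℝ) (h : E n → E m) (hf : ContDiff ℝ 2 f) (hh : ContDiff ℝ 2 h)
    (β : ℝ) (hβ : 0 < β) (xs : E n) (ys : E m) (hx0 : xs ≠ 0)
    (hstat : StrongLS s f h β xs ys)
    (δ₀ L₁ : ℝ) (hδ₀ : 0 < δ₀) (hL₁ : 0 < L₁)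
    (hLip : ∀ (x x' : E n) (y y' : E m), zNorm (x - xs) (y - ys) < δ₀ →
      zNorm (x' - xs) (y' - ys) < δ₀ →
      ‖gradL f h x y - gradL f h x' y'‖ ≤ L₁ * zNorm (x - x') (y - y'))
    (δstar : ℝ)
    (hδstar : δstar = min δ₀
      ((sInf ((fun i => |xs i|) '' (spt xs : Set (Fin n))) -
        β * sSup ((fun j => |gradL f h xs ys j|) '' ((spt xs : Set (Fin n))ᶜ))) /
        (Real.sqrt 2 * (1 + β * L₁))))
    (hcard : norm0 xs = s) :
    ∀ (x : E n) (y : E m), norm0 x ≤ s → zNorm (x - xs) (y - ys) < δstar →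
      Tsets s f h β x y = {spt x} ∧
      Tsets s f h β xs ys = {spt xs} ∧
      spt x = spt xs := by
  intro x y hx hz
  have hz0 : 0 ≤ zNorm (x - xs) (y - ys) := Real.sqrt_nonneg _
  have hzx : ‖x - xs‖ ≤ zNorm (x - xs) (y - ys) :=
    Real.le_sqrt_of_sq_le (by nlinarith [sq_nonneg ‖y - ys‖])
  rw [hδstar, lt_min_iff] at hz
  obtain ⟨hzδ, hzΔ⟩ := hz
  set M := sInf ((fun i => |xs i|) '' (spt xs : Set (Fin n))) with hM
  set Q := sSup ((fun j => |gradL f h xs ys j|) '' ((spt xs : Set (Fin n))ᶜ)) with hQ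
  set r := zNorm (x - xs) (y - ys) with hr
  have hβL : 0 < β * L₁ := mul_pos hβ hL₁
  rw [lt_div_iff₀ (by positivity)] at hzΔ
  have hmem : ∀ i, i ∈ spt xs ↔ xs i ≠ 0 := fun i => by simp [spt]
  have hMle : ∀ i ∈ spt xs, M ≤ |xs i| := fun i hi =>
    csInf_le ((Set.toFinite _).bddBelow) ⟨i, hi, rfl⟩
  have hQle : ∀ j ∉ spt xs, |gradL f h xs ys j| ≤ Q := fun j hj =>
    le_csSup ((Set.toFinite _).bddAbove) ⟨j, by simpa using hj, rfl⟩
  have hQ0 : 0 ≤ Q := Real.sSup_nonneg (by rintro _ ⟨j, _, rfl⟩; exact abs_nonneg _)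
  have hq0 : ∀ i ∈ spt xs, β * gradL f h xs ys i = 0 := fun i hi => by
    have := aux_zero xs (β • gradL f h xs ys) hstat.1 i ((hmem i).1 hi)
    simpa using this
  have hs2 : 1 ≤ Real.sqrt 2 := Real.one_le_sqrt.2 (by norm_num)
  have hβQ : 0 ≤ β * Q := mul_nonneg hβ.le hQ0
  have hΔ : 0 < M - β * Q := lt_of_le_of_lt (by positivity) hzΔ
  have hrM : r < M := by
    have : r * 1 ≤ r * (Real.sqrt 2 * (1 + β * L₁)) := by
      apply mul_le_mul_of_nonneg_left _ hz0
      nlinarith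
    linarith
  have hGcard : (spt xs).card = s := hcard
  -- support
  have hsub : spt xs ⊆ spt x := by
    intro i hi
    have h1 : |x i - xs i| ≤ ‖x - xs‖ := by
      simpa using PiLp.norm_apply_le (x - xs) i
    have h2 := hMle i hi
    simp only [spt, Finset.mem_filter, Finset.mem_univ, true_and]
    intro h0
    rw [h0, zero_sub, abs_neg] at h1
    linarith
  have hspt : spt x = spt xs :=
    (Finset.eq_of_subset_of_card_le hsub (by rw [hGcard]; exact hx)).symm
  -- base point
  have hbase : ∀ i ∈ spt xs, ∀ j ∉ spt xs,
      |(xs - β • gradL f h xs ys) j| + (M - β * Q) ≤ |(xs - β • gradL f h xs ys) i| := by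
    intro i hi j hj
    have hj0 : xs j = 0 := by
      by_contra hc
      exact hj ((hmem j).2 hc)
    have e1 : (xs - β • gradL f h xs ys) i = xs i := by simp [hq0 i hi]
    have e2 : |(xs - β • gradL f h xs ys) j| = β * |gradL f h xs ys j| := by
      simp [hj0, abs_mul, abs_of_pos hβ]
    rw [e1, e2]
    have := mul_le_mul_of_nonneg_left (hQle j hj) hβ.le
    linarith [hMle i hi]
  have hzs : zNorm (xs - xs) (ys - ys) < δ₀ := by simpa [zNorm] using hδ₀
  have hL := hLip x xs y ys hzδ hzs
  set u := x - β • gradL f h x y with hu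
  set us := xs - β • gradL f h xs ys with hus
  have hd : ‖u - us‖ ≤ (1 + β * L₁) * r := by
    have e : u - us = (x - xs) - β • (gradL f h x y - gradL f h xs ys) := by
      rw [hu, hus, smul_sub]; abel
    rw [e]
    refine (norm_sub_le _ _).trans ?_
    rw [norm_smul, Real.norm_of_nonneg hβ.le]
    have := mul_le_mul_of_nonneg_left hL hβ.le
    nlinarith
  refine ⟨?_, ?_, hspt⟩
  · rw [hspt]
    refine aux_uniq (fun i => u i) (spt xs) s hGcard ?_
    intro i hi j hj
    have hij : i ≠ j := by rintro rfl; exact hj hi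
    have h1 := aux_two (u - us) i j hij
    have h2 := mul_le_mul_of_nonneg_left hd (Real.sqrt_nonneg 2)
    have h3 := hbase i hi j hj
    simp only [PiLp.sub_apply] at h1
    have h4 := abs_sub_abs_le_abs_sub (us i) (u i)
    have h5 := abs_sub_abs_le_abs_sub (u j) (us j)
    rw [abs_sub_comm] at h4
    show |u j| < |u i|
    nlinarith
  · refine aux_uniq (fun i => us i) (spt xs) s hGcard ?_
    intro i hi j hj
    have h3 := hbase i hi j hj
    show |us j| < |us i|
    linarith

end
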